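/- arXiv:2602.05489 — 4 statements merged into one kernel-verified Lean document; each statement's English description precedes it below -/
import Mathlib

section
/- One-step progress: let f_i : ℝ^n → ℝ be convex and differentiable with L-Lipschitz gradient, let f be convex and differentiable with L-Lipschitz gradient, and let g : ℝ^n → ℝ ∪ {+∞} be proper, convex and lower semicontinuous. For the proximal step x_{t+1} = prox_{τg}(x_t − τ∇f_{i_t}(x_t)) with τ > 0, every z_t ∈ ℝ^n and every ε > 0: ‖x_{t+1} − z_t‖² − ‖x_t − z_t‖² ≤ 2τ[f_{i_t}(z_t) − f_{i_t}(x_t)] + 2τ(g(z_t) − g(x_{t+1})) + (τ/ε)·‖∇f_{i_t}(x_t) − ∇f(x_t)‖² + 2τ[f(x_t) − f(x_{t+1})] + (τε + τL − 1)·‖x_t − x_{t+1}‖². -/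
open MeasureTheory

section FirstOrder

variable {E : Type*} [NormedAddCommGroup E] [InnerProductSpace ℝ E]

theorem HasGradientAt.hasDerivAt_comp_add_smul [CompleteSpace E] {f : E → ℝ} {G x v : E} {t : ℝ}
    (hf : HasGradientAt f G (x + t • v)) :
    HasDerivAt (fun s : ℝ => f (x + s • v)) (inner ℝ G v) t := by
  have hline : HasDerivAt (fun s : ℝ => x + s • v) v t := by
    simpa using ((hasDerivAt_id t).smul_const v).const_add x
  simpa [Function.comp_def] using hf.hasFDerivAt.comp_hasDerivAt t hline

theorem ConvexOn.inner_gradient_le [CompleteSpace E] {f : E → ℝ} {G x : E}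
    (hconv : ConvexOn ℝ Set.univ f) (hf : HasGradientAt f G x) (y : E) :
    inner ℝ G (y - x) ≤ f y - f x := by
  have hline : ConvexOn ℝ Set.univ (fun s : ℝ => f (x + s • (y - x))) := by
    simpa [Function.comp_def, AffineMap.lineMap_apply, add_comm] using
      hconv.comp_affineMap (AffineMap.lineMap (k := ℝ) x y)
  have hderiv : HasDerivAt (fun s : ℝ => f (x + s • (y - x))) (inner ℝ G (y - x)) 0 :=
    HasGradientAt.hasDerivAt_comp_add_smul (by simpa using hf)
  simpa [slope_def_field] using
    hline.le_slope_of_hasDerivAt (Set.mem_univ 0) (Set.mem_univ 1) one_pos hderiv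

/-- The descent lemma for a function with Lipschitz gradient. -/
theorem le_add_inner_add_of_lipschitz_gradient [CompleteSpace E] {f : E → ℝ} {G : E → E} {L : ℝ}
    (hgrad : ∀ x, HasGradientAt f (G x) x) (hlip : ∀ x y, ‖G x - G y‖ ≤ L * ‖x - y‖) (x y : E) :
    f y ≤ f x + inner ℝ (G x) (y - x) + L / 2 * ‖y - x‖ ^ 2 := by
  set v := y - x with hv
  let φ : ℝ → ℝ := fun t => f (x + t • v) - t * inner ℝ (G x) v - L / 2 * ‖v‖ ^ 2 * t ^ 2
  have hφ (t : ℝ) : HasDerivAt φ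
      (inner ℝ (G (x + t • v)) v - inner ℝ (G x) v - L * ‖v‖ ^ 2 * t) t := by
    refine (((hgrad (x + t • v)).hasDerivAt_comp_add_smul.sub
      ((hasDerivAt_id t).mul_const (inner ℝ (G x) v))).sub
      ((hasDerivAt_pow 2 t).const_mul (L / 2 * ‖v‖ ^ 2))).congr_deriv ?_
    norm_num
    ring
  have hanti : AntitoneOn φ (Set.Icc 0 1) := by
    refine antitoneOn_of_deriv_nonpos (convex_Icc 0 1)
      (fun t _ => (hφ t).continuousAt.continuousWithinAt)
      (fun t _ => (hφ t).differentiableAt.differentiableWithinAt) fun t ht => ?_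
    rw [interior_Icc] at ht
    rw [(hφ t).deriv, ← inner_sub_left, sub_nonpos]
    calc inner ℝ (G (x + t • v) - G x) v ≤ ‖G (x + t • v) - G x‖ * ‖v‖ := real_inner_le_norm _ _
      _ ≤ L * ‖x + t • v - x‖ * ‖v‖ := by gcongr; exact hlip _ _
      _ = L * ‖v‖ ^ 2 * t := by
        rw [add_sub_cancel_left, norm_smul, Real.norm_of_nonneg ht.1.le]
        ring
  have h01 : φ 1 ≤ φ 0 := hanti (by simp) (by simp) zero_le_one
  simp only [φ, one_smul, zero_smul, hv, add_sub_cancel, add_zero] at h01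
  linarith

/-- The variational inequality characterising the proximal point. -/
theorem ConvexOn.inner_sub_prox_le {g : E → ℝ} (hg : ConvexOn ℝ Set.univ g) {τ : ℝ} (hτ : 0 ≤ τ)
    {y p : E} (hp : IsMinOn (fun w => τ * g w + ‖y - w‖ ^ 2 / 2) Set.univ p) (x : E) :
    inner ℝ (x - p) (y - p) ≤ τ * (g x - g p) := by
  have hsegment {t : ℝ} (ht : 0 < t) (ht1 : t ≤ 1) :
      inner ℝ (x - p) (y - p) ≤ τ * (g x - g p) + t * (‖x - p‖ ^ 2 / 2) := by
    have hmin : τ * g p + ‖y - p‖ ^ 2 / 2 ≤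
        τ * g ((1 - t) • p + t • x) + ‖y - ((1 - t) • p + t • x)‖ ^ 2 / 2 :=
      hp (Set.mem_univ _)
    have hconv : g ((1 - t) • p + t • x) ≤ (1 - t) * g p + t * g x :=
      hg.2 (Set.mem_univ _) (Set.mem_univ _) (sub_nonneg.2 ht1) ht.le (sub_add_cancel 1 t)
    have hnorm : ‖y - ((1 - t) • p + t • x)‖ ^ 2 =
        ‖y - p‖ ^ 2 - 2 * (t * inner ℝ (x - p) (y - p)) + t ^ 2 * ‖x - p‖ ^ 2 := by
      rw [show y - ((1 - t) • p + t • x) = (y - p) - t • (x - p) by module, norm_sub_sq_real,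
        inner_smul_right, real_inner_comm, norm_smul, mul_pow, Real.norm_eq_abs, sq_abs]
    have hτconv := mul_le_mul_of_nonneg_left hconv hτ
    refine le_of_mul_le_mul_left ?_ ht
    linarith
  have hlim : Filter.Tendsto (fun t : ℝ => τ * (g x - g p) + t * (‖x - p‖ ^ 2 / 2))
      (nhdsWithin 0 (Set.Ioi 0)) (nhds (τ * (g x - g p))) := by
    refine tendsto_nhdsWithin_of_tendsto_nhds (Continuous.tendsto' (by fun_prop) _ _ (by simp))
  refine ge_of_tendsto hlim ?_
  filter_upwards [Ioc_mem_nhdsGT (zero_lt_one (α := ℝ))] with t ht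
  exact hsegment ht.1 ht.2

theorem two_mul_inner_le_div_add_mul (a b : E) {ε : ℝ} (hε : 0 < ε) :
    2 * inner ℝ a b ≤ ‖a‖ ^ 2 / ε + ε * ‖b‖ ^ 2 := by
  have h := sq_nonneg (‖a‖ - ε * ‖b‖)
  have hinner := mul_le_mul_of_nonneg_left (real_inner_le_norm a b) hε.le
  rw [← sub_nonneg]
  have : ‖a‖ ^ 2 / ε + ε * ‖b‖ ^ 2 - 2 * inner ℝ a b =
      (‖a‖ ^ 2 + ε ^ 2 * ‖b‖ ^ 2 - 2 * (ε * inner ℝ a b)) / ε := by field_simp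
  rw [this]
  exact div_nonneg (by linarith) hε.le

end FirstOrder

/-- **One-step progress of a proximal-gradient step** (Lemma A.4).
Let `f_i` and `f` be convex and differentiable with `L`-Lipschitz gradients, and `g`
proper convex lower semicontinuous.  For the proximal step
`x_{t+1} = prox_{τg}(x_t − τ∇f_i(x_t))` with `τ > 0`, every `z` and every `ε > 0`:
`‖x_{t+1} − z‖² − ‖x_t − z‖² ≤ 2τ(f_i(z) − f_i(x_t)) + 2τ(g(z) − g(x_{t+1}))
  + (τ/ε)‖∇f_i(x_t) − ∇f(x_t)‖² + 2τ(f(x_t) − f(x_{t+1}))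
  + (τε + τL − 1)‖x_t − x_{t+1}‖²`. -/
theorem one_step_progress
    {n : ℕ}
    (L : ℝ) (hL : 0 < L)
    (fi : EuclideanSpace ℝ (Fin n) → ℝ)
    (Gfi : EuclideanSpace ℝ (Fin n) → EuclideanSpace ℝ (Fin n))
    (hficonv : ConvexOn ℝ Set.univ fi)
    (hfigrad : ∀ x, HasGradientAt fi (Gfi x) x)
    (hfilip : ∀ x y, ‖Gfi x - Gfi y‖ ≤ L * ‖x - y‖)
    (f : EuclideanSpace ℝ (Fin n) → ℝ)
    (Gf : EuclideanSpace ℝ (Fin n) → EuclideanSpace ℝ (Fin n))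
    (hfconv : ConvexOn ℝ Set.univ f)
    (hfgrad : ∀ x, HasGradientAt f (Gf x) x)
    (hflip : ∀ x y, ‖Gf x - Gf y‖ ≤ L * ‖x - y‖)
    (g : EuclideanSpace ℝ (Fin n) → ℝ)
    (hgconv : ConvexOn ℝ Set.univ g)
    (hglsc : LowerSemicontinuous g)
    (τ : ℝ) (hτ : 0 < τ)
    (xt xnext : EuclideanSpace ℝ (Fin n))
    -- `xnext = prox_{τ g}(x_t − τ ∇f_i(x_t))`
    (hprox : IsMinOn (fun w => τ * g w + ‖(xt - τ • Gfi xt) - w‖ ^ 2 / 2)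
      Set.univ xnext)
    (z : EuclideanSpace ℝ (Fin n)) (ε : ℝ) (hε : 0 < ε) :
    ‖xnext - z‖ ^ 2 - ‖xt - z‖ ^ 2 ≤
      2 * τ * (fi z - fi xt) + 2 * τ * (g z - g xnext)
        + (τ / ε) * ‖Gfi xt - Gf xt‖ ^ 2
        + 2 * τ * (f xt - f xnext)
        + (τ * ε + τ * L - 1) * ‖xt - xnext‖ ^ 2 := by
  have hprox_le := hgconv.inner_sub_prox_le hτ.le hprox z
  have hfi := mul_le_mul_of_nonneg_left (hficonv.inner_gradient_le (hfigrad xt) z) hτ.le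
  have hdescent := mul_le_mul_of_nonneg_left
    (le_add_inner_add_of_lipschitz_gradient hfgrad hflip xt xnext) hτ.le
  have hyoung := mul_le_mul_of_nonneg_left
    (two_mul_inner_le_div_add_mul (Gfi xt - Gf xt) (xt - xnext) hε) hτ.le
  have hexpand : ‖xt - z‖ ^ 2 =
      ‖xt - xnext‖ ^ 2 - 2 * inner ℝ (z - xnext) (xt - xnext) + ‖xnext - z‖ ^ 2 := by
    rw [← sub_sub_sub_cancel_right xt z xnext, norm_sub_sq_real, real_inner_comm,
      norm_sub_rev z xnext]
  have hsplit : inner ℝ (z - xnext) (xt - τ • Gfi xt - xnext) =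
      inner ℝ (z - xnext) (xt - xnext) - τ * (inner ℝ (Gfi xt) (z - xt)
        + inner ℝ (Gfi xt - Gf xt) (xt - xnext) - inner ℝ (Gf xt) (xnext - xt)) := by
    rw [sub_right_comm, inner_sub_right, inner_smul_right, real_inner_comm (Gfi xt)]
    simp only [inner_sub_left, inner_sub_right]
    ring
  rw [norm_sub_rev xnext xt] at hdescent
  rw [div_mul_eq_mul_div, mul_div_assoc]
  linarith
end

section
/- Let T ≥ 1 be an integer and a ∈ (0,1]. Define α_0 = α_{−1} = 1 and α_t = ((T − t + 2)/(T − t + 1 + a))·α_{t−1} for t = 1,…,T. Then α_T ≥ (T+1)^{1−a} / 2^{1−a}. -/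
/-- A Bernoulli-type bound, the single-step form of Gautschi's inequality. -/
theorem rpow_add_two_div_add_one_le {k a : ℝ} (hk : 0 < k) (ha0 : 0 < a) (ha1 : a ≤ 1) :
    ((k + 2) / (k + 1)) ^ (1 - a) ≤ (k + 1) / (k + a) := by
  have hk1 : 0 < k + 1 := by linarith
  have hka : 0 < k + a := by linarith
  have hs : 0 < 1 / (k + 1) := by positivity
  have h := rpow_one_add_le_one_add_mul_self (s := 1 / (k + 1)) (p := 1 - a)
    (by linarith) (by linarith) (by linarith)
  have e1 : 1 + 1 / (k + 1) = (k + 2) / (k + 1) := by field_simp; ring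
  have e2 : 1 + (1 - a) * (1 / (k + 1)) = (k + 2 - a) / (k + 1) := by field_simp; ring
  rw [e1, e2] at h
  refine h.trans ?_
  rw [div_le_div_iff₀ hk1 hka]
  nlinarith [sq_nonneg (1 - a)]

/-- Every term of the weight sequence dominates a power of `(T + 2) / (T - t + 2)`. -/
theorem rpow_div_le_of_weight_rec (T : ℕ) (a : ℝ) (ha0 : 0 < a) (ha1 : a ≤ 1)
    (α : ℕ → ℝ) (hα0 : α 0 = 1)
    (hαrec : ∀ t : ℕ, 1 ≤ t → t ≤ T →
      α t = (((T : ℝ) - t + 2) / ((T : ℝ) - t + 1 + a)) * α (t - 1))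
    (t : ℕ) (ht : t ≤ T) :
    (((T : ℝ) + 2) / ((T : ℝ) - t + 2)) ^ (1 - a) ≤ α t := by
  induction t with
  | zero =>
    have hT : (T : ℝ) + 2 ≠ 0 := by positivity
    simp [hα0, hT]
  | succ t ih =>
    have hk : 0 < (T : ℝ) - t := sub_pos.2 (by exact_mod_cast ht)
    have hk1 : 0 < (T : ℝ) - t + 1 := by linarith
    have hk2 : 0 < (T : ℝ) - t + 2 := by linarith
    have hka : 0 < (T : ℝ) - t + a := by linarith
    rw [hαrec (t + 1) (by omega) ht, Nat.add_sub_cancel]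
    push_cast
    have e0 : (T : ℝ) - (t + 1) + 1 = T - t := by ring
    have e1 : (T : ℝ) - (t + 1) + 2 = T - t + 1 := by ring
    have e : ((T : ℝ) + 2) / (T - t + 1) =
        ((T - t + 2) / (T - t + 1)) * ((T + 2) / (T - t + 2)) := by
      field_simp
    rw [e0, e1, e, Real.mul_rpow (by positivity) (by positivity)]
    exact mul_le_mul (rpow_add_two_div_add_one_le hk ha0 ha1) (ih (by omega))
      (by positivity) (by positivity)


/-- **Lower bound on the weight sequence** (Lemma A.5, part 1).
Let `T ≥ 1` and `a ∈ (0,1]`.  With `α₀ = α₋₁ = 1` and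
`α_t = ((T − t + 2)/(T − t + 1 + a)) α_{t−1}` for `t = 1,…,T`, one has
`α_T ≥ (T+1)^{1−a} / 2^{1−a}`. -/
theorem alpha_lower_bound
    (T : ℕ) (hT : 1 ≤ T)
    (a : ℝ) (ha0 : 0 < a) (ha1 : a ≤ 1)
    (α : ℕ → ℝ) (hα0 : α 0 = 1)
    (hαrec : ∀ t : ℕ, 1 ≤ t → t ≤ T →
      α t = (((T : ℝ) - t + 2) / ((T : ℝ) - t + 1 + a)) * α (t - 1)) :
    ((T : ℝ) + 1) ^ (1 - a) / 2 ^ (1 - a) ≤ α T := by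
  have h := rpow_div_le_of_weight_rec T a ha0 ha1 α hα0 hαrec T le_rfl
  rw [sub_self, zero_add] at h
  rw [← Real.div_rpow (by positivity) zero_le_two]
  refine le_trans (Real.rpow_le_rpow (by positivity) ?_ (by linarith)) h
  gcongr
  norm_num
end

section
/- Let T ≥ 1 be an integer and a ∈ (0,1]. Define α_0 = α_{−1} = 1 and α_t = ((T − t + 2)/(T − t + 1 + a))·α_{t−1} for t = 1,…,T. Then (Σ_{t=1}^T α_t)/α_T ≤ 4·(1 + (T^a − 1)/a). -/
/-- A consequence of Bernoulli's inequality `(1 - 1 / x) ^ a ≤ 1 - a / x`. -/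
lemma sub_one_rpow_mul_add_le {x a : ℝ} (hx : 1 ≤ x) (ha0 : 0 ≤ a) (ha1 : a ≤ 1) :
    (x - 1) ^ a * (x + a) ≤ x ^ a * x := by
  have hx0 : 0 < x := by linarith
  have hinv : 1 / x ≤ 1 := by rw [div_le_one hx0]; exact hx
  have hB : (1 + -(1 / x)) ^ a ≤ 1 + a * -(1 / x) :=
    rpow_one_add_le_one_add_mul_self (by linarith) ha0 ha1
  have hfac : (x - 1) ^ a = x ^ a * (1 + -(1 / x)) ^ a := by
    rw [← Real.mul_rpow hx0.le (by linarith)]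
    congr 1
    field_simp
    ring
  have hprod : (1 + a * -(1 / x)) * (x + a) ≤ x := by
    have h : (1 + a * -(1 / x)) * (x + a) = x - a ^ 2 / x := by
      field_simp
      ring
    have : 0 ≤ a ^ 2 / x := by positivity
    linarith
  rw [hfac, mul_assoc]
  gcongr
  exact (mul_le_mul_of_nonneg_right hB (by linarith)).trans hprod

section WeightSequence

variable {T : ℕ} {a : ℝ} {α : ℕ → ℝ}

/-- The recursion of the weight sequence with denominators cleared. -/
lemma weight_recursion_mul (ha0 : 0 < a)
    (hαrec : ∀ t : ℕ, 1 ≤ t → t ≤ T →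
      α t = (((T : ℝ) - t + 2) / ((T : ℝ) - t + 1 + a)) * α (t - 1))
    {n : ℕ} (hn : n + 1 ≤ T) :
    ((T : ℝ) - n + a) * α (n + 1) = ((T : ℝ) - n + 1) * α n := by
  have hnT : (n : ℝ) + 1 ≤ T := by exact_mod_cast hn
  have hne : (T : ℝ) - (n + 1) + 1 + a ≠ 0 := by linarith
  have h := hαrec (n + 1) (by omega) hn
  rw [Nat.add_sub_cancel, Nat.cast_add_one, div_mul_eq_mul_div, eq_div_iff hne] at h
  linarith

/-- The weighted sequence `(T - n + 1) * α n` telescopes. -/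
lemma mul_sum_weight_eq (hα0 : α 0 = 1)
    (hrec : ∀ n : ℕ, n + 1 ≤ T → ((T : ℝ) - n + a) * α (n + 1) = ((T : ℝ) - n + 1) * α n)
    {n : ℕ} (hn : n ≤ T) :
    a * ∑ t ∈ Finset.Icc 1 n, α t = (T + 1) - ((T : ℝ) - n + 1) * α n := by
  induction n with
  | zero => simp [hα0]
  | succ n ih =>
    rw [Finset.sum_Icc_succ_top (by omega), mul_add, ih (by omega)]
    push_cast
    linarith [hrec n hn]

lemma weight_pos (ha0 : 0 < a) (hα0 : α 0 = 1)
    (hrec : ∀ n : ℕ, n + 1 ≤ T → ((T : ℝ) - n + a) * α (n + 1) = ((T : ℝ) - n + 1) * α n)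
    {n : ℕ} (hn : n ≤ T) : 0 < α n := by
  induction n with
  | zero => simp [hα0]
  | succ n ih =>
    have hnT : (n : ℝ) + 1 ≤ T := by exact_mod_cast hn
    have h : 0 < ((T : ℝ) - n + a) * α (n + 1) := by
      rw [hrec n hn]
      exact mul_pos (by linarith) (ih (by omega))
    exact pos_of_mul_pos_right h (by linarith)

/-- Lower bound on the weights before the last one. -/
lemma add_one_mul_rpow_le_weight (ha0 : 0 < a) (ha1 : a ≤ 1) (hα0 : α 0 = 1)
    (hrec : ∀ n : ℕ, n + 1 ≤ T → ((T : ℝ) - n + a) * α (n + 1) = ((T : ℝ) - n + 1) * α n)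
    {n : ℕ} (hn : n + 1 ≤ T) :
    ((T : ℝ) + 1) * ((T : ℝ) - n) ^ a ≤ ((T : ℝ) - n + 1) * α n * (T : ℝ) ^ a := by
  induction n with
  | zero => simp [hα0]
  | succ n ih =>
    have hnT : (n : ℝ) + 1 + 1 ≤ T := by exact_mod_cast hn
    have hx : 0 < (T : ℝ) - n + a := by linarith
    have hB := sub_one_rpow_mul_add_le (x := (T : ℝ) - n) (by linarith) ha0.le ha1
    refine le_of_mul_le_mul_right ?_ hx
    push_cast
    calc ((T : ℝ) + 1) * ((T : ℝ) - (n + 1)) ^ a * ((T : ℝ) - n + a)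
        = (T + 1) * (((T : ℝ) - n - 1) ^ a * ((T : ℝ) - n + a)) := by
          rw [sub_sub, mul_assoc]
      _ ≤ (T + 1) * (((T : ℝ) - n) ^ a * ((T : ℝ) - n)) := by gcongr
      _ = (T + 1) * ((T : ℝ) - n) ^ a * ((T : ℝ) - n) := by ring
      _ ≤ ((T : ℝ) - n + 1) * α n * (T : ℝ) ^ a * ((T : ℝ) - n) :=
          mul_le_mul_of_nonneg_right (ih (by omega)) (by linarith)
      _ = ((T : ℝ) - (n + 1) + 1) * α (n + 1) * (T : ℝ) ^ a * ((T : ℝ) - n + a) := by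
          rw [← hrec n (by omega)]
          ring

end WeightSequence


/-- **Bound on the normalized sum of the weight sequence** (Lemma A.5, part 2).
Let `T ≥ 1` and `a ∈ (0,1]`.  With `α₀ = α₋₁ = 1` and
`α_t = ((T − t + 2)/(T − t + 1 + a)) α_{t−1}` for `t = 1,…,T`, one has
`(Σ_{t=1}^T α_t)/α_T ≤ 4 (1 + (T^a − 1)/a)`. -/
theorem alpha_sum_bound
    (T : ℕ) (hT : 1 ≤ T)
    (a : ℝ) (ha0 : 0 < a) (ha1 : a ≤ 1)
    (α : ℕ → ℝ) (hα0 : α 0 = 1)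
    (hαrec : ∀ t : ℕ, 1 ≤ t → t ≤ T →
      α t = (((T : ℝ) - t + 2) / ((T : ℝ) - t + 1 + a)) * α (t - 1)) :
    (∑ t ∈ Finset.Icc 1 T, α t) / α T ≤ 4 * (1 + ((T : ℝ) ^ a - 1) / a) := by
  have hrec : ∀ n : ℕ, n + 1 ≤ T →
      ((T : ℝ) - n + a) * α (n + 1) = ((T : ℝ) - n + 1) * α n :=
    fun n hn => weight_recursion_mul ha0 hαrec hn
  have hpos : 0 < α T := weight_pos ha0 hα0 hrec le_rfl
  have hsum := mul_sum_weight_eq hα0 hrec (le_refl T)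
  have hlast : (T : ℝ) + 1 ≤ (1 + a) * α T * (T : ℝ) ^ a := by
    obtain ⟨m, rfl⟩ : ∃ m, T = m + 1 := ⟨T - 1, by omega⟩
    have hlow := add_one_mul_rpow_le_weight ha0 ha1 hα0 hrec (le_refl (m + 1))
    rw [← hrec m le_rfl] at hlow
    simpa using hlow
  have hTa : 1 ≤ (T : ℝ) ^ a := Real.one_le_rpow (by exact_mod_cast hT) ha0.le
  have hscalar : (1 + a) * (T : ℝ) ^ a - 1 ≤ 4 * (a + ((T : ℝ) ^ a - 1)) := by nlinarith
  have hbound : a * ∑ t ∈ Finset.Icc 1 T, α t ≤ 4 * (a + ((T : ℝ) ^ a - 1)) * α T := by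
    calc a * ∑ t ∈ Finset.Icc 1 T, α t
        ≤ ((1 + a) * (T : ℝ) ^ a - 1) * α T := by linarith
      _ ≤ _ := by gcongr
  rw [div_le_iff₀ hpos]
  refine le_of_mul_le_mul_left (hbound.trans_eq ?_) ha0
  field_simp
end

section
/- Let T ≥ 1, a ∈ (0,1), and let (α_t) satisfy α_{−1} = α_0 = 1 and α_{t−1}(T − t + 2) − α_t(a + T − t + 1) = 0 for t = 1,…,T. Then for any real numbers r_0, r_1, …, r_{T+1}, Σ_{t=0}^T [ α_t r_{t+1} − a α_t r_t − Σ_{s=0}^t (α_s − α_{s−1}) r_s ] = α_T r_{T+1} − a r_0 − Σ_{t=0}^T (α_t − α_{t−1})(T − t + 1) r_t + Σ_{t=1}^T r_t (α_{t−1}(T−t+2) − α_t(a+T−t+1)) + ... ; in particular, after regrouping, Σ_{t=0}^T [ α_t r_{t+1} − a α_t r_t − Σ_{s=0}^t (α_s − α_{s−1}) r_s ] = α_T r_{T+1} − a r_0. -/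
/-- **Telescoping identity for the weighted per-iteration bounds** (auxiliary identity).
Let `T ≥ 1`, `a ∈ (0,1)`, and let `α₋₁ = α₀ = 1` satisfy
`α_{t−1}(T − t + 2) − α_t(a + T − t + 1) = 0` for `t = 1,…,T`.  Then for any reals
`r_0, …, r_{T+1}`,
`Σ_{t=0}^T [α_t r_{t+1} − a α_t r_t − Σ_{s=0}^t (α_s − α_{s−1}) r_s]
  = α_T r_{T+1} − a r_0`. -/
theorem telescoping_identity
    (T : ℕ) (hT : 1 ≤ T)
    (a : ℝ) (ha0 : 0 < a) (ha1 : a < 1)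
    (α : ℤ → ℝ) (hαm1 : α (-1) = 1) (hα0 : α 0 = 1)
    (hαrec : ∀ t : ℕ, 1 ≤ t → t ≤ T →
      α ((t : ℤ) - 1) * ((T : ℝ) - t + 2) - α t * (a + (T : ℝ) - t + 1) = 0)
    (r : ℕ → ℝ) :
    ∑ t ∈ Finset.range (T + 1),
        (α t * r (t + 1) - a * α t * r t
          - ∑ s ∈ Finset.range (t + 1), (α s - α ((s : ℤ) - 1)) * r s)
      = α T * r (T + 1) - a * r 0 := by
  have partial_sum : ∀ n : ℕ, n ≤ T →
      ∑ t ∈ Finset.range (n + 1),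
        (α t * r (t + 1) - a * α t * r t
          - ∑ s ∈ Finset.range (t + 1), (α s - α ((s : ℤ) - 1)) * r s)
      = α n * r (n + 1) - a * r 0
        + ((T : ℝ) - n) * ∑ s ∈ Finset.range (n + 1), (α s - α ((s : ℤ) - 1)) * r s := by
    intro n
    induction n with
    | zero => intro _; simp [hα0, hαm1]
    | succ n ih =>
      intro hn
      have hrec := hαrec (n + 1) (by omega) hn
      rw [Finset.sum_range_succ, ih (by omega),
        Finset.sum_range_succ (fun s : ℕ => (α s - α ((s : ℤ) - 1)) * r s) (n + 1)]
      push_cast at hrec ⊢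
      rw [add_sub_cancel_right] at hrec ⊢
      linear_combination r (n + 1) * hrec
  simpa using partial_sum T le_rfl
end
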